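/- arXiv:2303.18168 — 3 statements merged into one kernel-verified Lean document; each statement's English description precedes it below -/
import Mathlib

section
/- Let d = 2 and fix δ ∈ (0,2). There exists a constant C(δ) < ∞, depending only on δ (independent of U, κ and f), such that for every κ > 0, every C² ℤ²-periodic U : ℝ² → ℝ, with μ the probability measure on [0,1)² with density e^{-U/κ}/Z (Z = ∫_{[0,1)²} e^{-U/κ} dx), every C¹ ℤ²-periodic f with ∫ f dμ = 0 satisfies ‖f‖_{L²(μ)}^{4−δ} ≤ C(δ) exp(4‖U‖_osc/κ) ‖∇f‖_{L²(μ)}² ‖f‖_{L¹(μ)}^{2−δ}. -/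
open MeasureTheory

/-- The fundamental domain `[0,1)²` of the torus. -/
def box : Set (Fin 2 → ℝ) := Set.univ.pi fun _ => Set.Ico (0:ℝ) 1

/-- The `i`-th partial derivative of `f : ℝ² → ℝ` at `x`. -/
noncomputable def pd (f : (Fin 2 → ℝ) → ℝ) (i : Fin 2) (x : Fin 2 → ℝ) : ℝ :=
  fderiv ℝ f x (Pi.single i 1)

/-- `ℤ²`-periodicity of a function on `ℝ²`. -/
def Per (f : (Fin 2 → ℝ) → ℝ) : Prop :=
  ∀ x : Fin 2 → ℝ, ∀ m : Fin 2 → ℤ, f (x + fun i => (m i : ℝ)) = f x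

/-- The probability measure `μ` on `[0,1)²` with density `ρ∞ = e^{-U/κ}/Z`. -/
noncomputable def μm (κ : ℝ) (U : (Fin 2 → ℝ) → ℝ) : Measure (Fin 2 → ℝ) :=
  (volume.restrict box).withDensity fun x =>
    ENNReal.ofReal (Real.exp (-(U x) / κ) / ∫ y in box, Real.exp (-(U y) / κ))

/-- The oscillation `‖U‖_osc = max U - min U` of a (bounded) function. -/
noncomputable def oscU (U : (Fin 2 → ℝ) → ℝ) : ℝ :=
  sSup (Set.range U) - sInf (Set.range U)

/-- Lebesgue measure on the unit interval `[0,1)`. -/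
noncomputable def unitVol : Measure ℝ := volume.restrict (Set.Ico 0 1)

instance : IsProbabilityMeasure unitVol := ⟨by simp [unitVol]⟩

lemma ae_mem_unitVol : ∀ᵐ x ∂unitVol, x ∈ Set.Ico (0:ℝ) 1 :=
  ae_restrict_mem measurableSet_Ico

lemma unitVol_prod :
    unitVol.prod unitVol = volume.restrict (Set.Ico (0:ℝ) 1 ×ˢ Set.Ico (0:ℝ) 1) := by
  rw [unitVol, Measure.prod_restrict, ← Measure.volume_eq_prod]

lemma ae_mem_unitVol_prod :
    ∀ᵐ z ∂(unitVol.prod unitVol), z ∈ Set.Ico (0:ℝ) 1 ×ˢ Set.Ico (0:ℝ) 1 := by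
  rw [unitVol_prod]
  exact ae_restrict_mem (measurableSet_Ico.prod measurableSet_Ico)

lemma Continuous.integrable_unitVol {h : ℝ → ℝ} (hh : Continuous h) : Integrable h unitVol :=
  (hh.continuousOn.integrableOn_compact (isCompact_Icc (a := (0:ℝ)) (b := 1))).mono_set
    Set.Ico_subset_Icc_self

lemma Continuous.integrable_unitVol_prod {h : ℝ × ℝ → ℝ} (hh : Continuous h) :
    Integrable h (unitVol.prod unitVol) := by
  rw [unitVol_prod]
  exact (hh.continuousOn.integrableOn_compact
    ((isCompact_Icc (a := (0:ℝ)) (b := 1)).prod (isCompact_Icc (a := (0:ℝ)) (b := 1)))).mono_set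
    (Set.prod_mono Set.Ico_subset_Icc_self Set.Ico_subset_Icc_self)

/-- The Cauchy–Schwarz inequality for integrals of real functions. -/
lemma sq_integral_mul_le {α : Type*} [MeasurableSpace α] {μ : Measure α} {a b : α → ℝ}
    (ha : Integrable (fun x => a x ^ 2) μ) (hb : Integrable (fun x => b x ^ 2) μ)
    (hab : Integrable (fun x => a x * b x) μ) :
    (∫ x, a x * b x ∂μ) ^ 2 ≤ (∫ x, a x ^ 2 ∂μ) * ∫ x, b x ^ 2 ∂μ := by
  have key : ∀ t : ℝ, 0 ≤ (∫ x, a x ^ 2 ∂μ) * (t * t) + (2 * ∫ x, a x * b x ∂μ) * t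
      + ∫ x, b x ^ 2 ∂μ := by
    intro t
    have h0 : 0 ≤ ∫ x, (t * a x + b x) ^ 2 ∂μ := integral_nonneg fun x => sq_nonneg _
    have h1 : ∫ x, (t * a x + b x) ^ 2 ∂μ
        = ∫ x, ((t * t) * a x ^ 2 + (2 * t) * (a x * b x) + b x ^ 2) ∂μ := by
      congr 1; ext x; ring
    have hsum : Integrable (fun x => (t * t) * a x ^ 2 + (2 * t) * (a x * b x)) μ :=
      (ha.const_mul _).add (hab.const_mul _)
    rw [h1, integral_add hsum hb, integral_add (ha.const_mul _) (hab.const_mul _), integral_const_mul,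
      integral_const_mul] at h0
    linarith
  have := discrim_le_zero key
  rw [discrim] at this
  linarith

section OneDim

variable {h h' : ℝ → ℝ} (hd : ∀ x, HasDerivAt h (h' x) x) (hc : Continuous h')
include hd hc

lemma abs_sub_le_integral_abs_deriv {x y : ℝ} (hx : x ∈ Set.Ico (0:ℝ) 1)
    (hy : y ∈ Set.Ico (0:ℝ) 1) : |h x - h y| ≤ ∫ r, |h' r| ∂unitVol := by
  rw [← intervalIntegral.integral_eq_sub_of_hasDerivAt (fun r _ => hd r)
    (hc.intervalIntegrable y x)]
  refine (intervalIntegral.norm_integral_le_integral_norm_uIoc (f := h')).trans ?_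
  refine setIntegral_mono_set hc.abs.integrable_unitVol
    (ae_of_all _ fun r => abs_nonneg _) (Filter.Eventually.of_forall fun r hr => ?_)
  exact ⟨(le_min hy.1 hx.1).trans hr.1.le, hr.2.trans_lt (max_lt hy.2 hx.2)⟩

lemma sq_sub_le_integral_sq_deriv {x y : ℝ} (hx : x ∈ Set.Ico (0:ℝ) 1)
    (hy : y ∈ Set.Ico (0:ℝ) 1) : (h x - h y) ^ 2 ≤ ∫ r, h' r ^ 2 ∂unitVol := by
  have h1 := abs_sub_le_integral_abs_deriv hd hc hx hy
  have h2 := sq_integral_mul_le (μ := unitVol) (a := fun r => |h' r|) (b := fun _ => 1)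
    (hc.abs.pow 2).integrable_unitVol (integrable_const _)
    (hc.abs.mul continuous_const).integrable_unitVol
  simp only [mul_one, sq_abs, one_pow, integral_const, probReal_univ, smul_eq_mul] at h2
  rw [← sq_abs]
  exact (pow_le_pow_left₀ (abs_nonneg _) h1 2).trans h2

lemma abs_le_integral_abs_add {x : ℝ} (hx : x ∈ Set.Ico (0:ℝ) 1) :
    |h x| ≤ ∫ r, (|h r| + |h' r|) ∂unitVol := by
  have hcont : Continuous h := continuous_iff_continuousAt.2 fun x => (hd x).continuousAt
  have h1 : ∫ _, |h x| ∂unitVol ≤ ∫ y, (|h y| + ∫ r, |h' r| ∂unitVol) ∂unitVol := by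
    refine integral_mono_ae (integrable_const _)
      (hcont.abs.add continuous_const).integrable_unitVol ?_
    filter_upwards [ae_mem_unitVol] with y hy
    have := abs_sub_le_integral_abs_deriv hd hc hx hy
    have := abs_sub_abs_le_abs_sub (h x) (h y)
    linarith
  rw [integral_add hcont.abs.integrable_unitVol (integrable_const _)] at h1
  rw [integral_add hcont.abs.integrable_unitVol hc.abs.integrable_unitVol]
  simpa using h1

lemma sq_le_integral_sq_add {x : ℝ} (hx : x ∈ Set.Ico (0:ℝ) 1) :
    h x ^ 2 ≤ ∫ r, (h r ^ 2 + 2 * |h r * h' r|) ∂unitVol := by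
  have hcont : Continuous h := continuous_iff_continuousAt.2 fun x => (hd x).continuousAt
  have := abs_le_integral_abs_add (h := fun r => h r ^ 2) (h' := fun r => 2 * (h r * h' r))
    (fun r => by simpa [mul_assoc] using (hd r).fun_pow 2) (by fun_prop) hx
  simpa [abs_mul] using this

end OneDim

section TwoDim

variable {F G₁ G₂ : ℝ × ℝ → ℝ} (hF : Continuous F) (hG₁ : Continuous G₁) (hG₂ : Continuous G₂)
  (hd₁ : ∀ s t, HasDerivAt (fun r => F (r, t)) (G₁ (s, t)) s)
  (hd₂ : ∀ s t, HasDerivAt (fun r => F (s, r)) (G₂ (s, t)) t)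
include hF hG₁ hG₂ hd₁ hd₂

/-- Ladyzhenskaya's inequality in product form. -/
lemma integral_pow_four_le :
    ∫ z, F z ^ 4 ∂(unitVol.prod unitVol) ≤
      (∫ z, (F z ^ 2 + 2 * |F z * G₁ z|) ∂(unitVol.prod unitVol)) *
        ∫ z, (F z ^ 2 + 2 * |F z * G₂ z|) ∂(unitVol.prod unitVol) := by
  have i₁ : Integrable (fun z => F z ^ 2 + 2 * |F z * G₁ z|) (unitVol.prod unitVol) :=
    Continuous.integrable_unitVol_prod (by fun_prop)
  have i₂ : Integrable (fun z => F z ^ 2 + 2 * |F z * G₂ z|) (unitVol.prod unitVol) :=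
    Continuous.integrable_unitVol_prod (by fun_prop)
  rw [integral_prod_symm _ i₁, integral_prod _ i₂, mul_comm, ← integral_prod_mul]
  refine integral_mono_ae (Continuous.integrable_unitVol_prod (by fun_prop))
    (i₂.integral_prod_left.mul_prod i₁.integral_prod_right) ?_
  filter_upwards [ae_mem_unitVol_prod] with z hz
  obtain ⟨s, t⟩ := z
  have b₁ := sq_le_integral_sq_add (h := fun r => F (r, t)) (h' := fun r => G₁ (r, t))
    (fun r => hd₁ r t) (by fun_prop) hz.1
  have b₂ := sq_le_integral_sq_add (h := fun r => F (s, r)) (h' := fun r => G₂ (s, r))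
    (fun r => hd₂ s r) (by fun_prop) hz.2
  calc F (s, t) ^ 4 = F (s, t) ^ 2 * F (s, t) ^ 2 := by ring
    _ ≤ _ := mul_le_mul b₂ b₁ (sq_nonneg _) ((sq_nonneg _).trans b₂)

lemma integral_sq_pow_two_le {B : ℝ} (hB0 : 0 ≤ B)
    (hB : ∫ z, F z ^ 2 ∂(unitVol.prod unitVol) ≤
      B * ∫ z, (G₁ z ^ 2 + G₂ z ^ 2) ∂(unitVol.prod unitVol)) :
    (∫ z, F z ^ 2 ∂(unitVol.prod unitVol)) ^ 2 ≤
      (2 * B + 4) * (∫ z, |F z| ∂(unitVol.prod unitVol)) ^ 2 *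
        ∫ z, (G₁ z ^ 2 + G₂ z ^ 2) ∂(unitVol.prod unitVol) := by
  have ci {g : ℝ × ℝ → ℝ} (hg : Continuous g) := hg.integrable_unitVol_prod
  have hQ := integral_pow_four_le hF hG₁ hG₂ hd₁ hd₂
  rw [integral_add (ci (by fun_prop)) (ci (by fun_prop)),
    integral_add (ci (by fun_prop)) (ci (by fun_prop)), integral_const_mul,
    integral_const_mul] at hQ
  have hs {g : ℝ × ℝ → ℝ} (hg : Continuous g) :
      (∫ z, |F z * g z| ∂(unitVol.prod unitVol)) ^ 2 ≤
        (∫ z, F z ^ 2 ∂(unitVol.prod unitVol)) * ∫ z, g z ^ 2 ∂(unitVol.prod unitVol) := by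
    simpa [abs_mul] using sq_integral_mul_le (μ := unitVol.prod unitVol)
      (a := fun z => |F z|) (b := fun z => |g z|)
      (ci (by fun_prop)) (ci (by fun_prop)) (ci (by fun_prop))
  have h13 : (∫ z, F z ^ 2 ∂(unitVol.prod unitVol)) ^ 2 ≤
      (∫ z, |F z| ∂(unitVol.prod unitVol)) * ∫ z, |F z| ^ 3 ∂(unitVol.prod unitVol) := by
    have := sq_integral_mul_le (μ := unitVol.prod unitVol)
      (a := fun z => Real.sqrt |F z|) (b := fun z => Real.sqrt |F z| * |F z|)
      (ci (by fun_prop)) (ci (by fun_prop)) (ci (by fun_prop))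
    have e1 (z : ℝ × ℝ) : Real.sqrt |F z| * (Real.sqrt |F z| * |F z|) = F z ^ 2 := by
      rw [← mul_assoc, Real.mul_self_sqrt (abs_nonneg _), ← sq, sq_abs]
    have e2 (z : ℝ × ℝ) : (Real.sqrt |F z| * |F z|) ^ 2 = |F z| ^ 3 := by
      rw [mul_pow, Real.sq_sqrt (abs_nonneg _)]; ring
    simpa only [e1, e2, Real.sq_sqrt (abs_nonneg _)] using this
  have h24 : (∫ z, |F z| ^ 3 ∂(unitVol.prod unitVol)) ^ 2 ≤
      (∫ z, F z ^ 2 ∂(unitVol.prod unitVol)) * ∫ z, F z ^ 4 ∂(unitVol.prod unitVol) := by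
    have := sq_integral_mul_le (μ := unitVol.prod unitVol)
      (a := fun z => |F z|) (b := fun z => F z ^ 2)
      (ci (by fun_prop)) (ci (by fun_prop)) (ci (by fun_prop))
    have e1 (z : ℝ × ℝ) : |F z| * F z ^ 2 = |F z| ^ 3 := by rw [← sq_abs]; ring
    have e2 (z : ℝ × ℝ) : (F z ^ 2) ^ 2 = F z ^ 4 := by ring
    simpa only [e1, e2, sq_abs] using this
  have k₁ := hs hG₁
  have k₂ := hs hG₂
  rw [integral_add (ci (by fun_prop)) (ci (by fun_prop))] at hB ⊢
  have hI : 0 ≤ ∫ z, F z ^ 2 ∂(unitVol.prod unitVol) := integral_nonneg fun z => sq_nonneg _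
  have hK : 0 ≤ ∫ z, |F z| ∂(unitVol.prod unitVol) := integral_nonneg fun z => abs_nonneg _
  have hD₁ : 0 ≤ ∫ z, G₁ z ^ 2 ∂(unitVol.prod unitVol) := integral_nonneg fun z => sq_nonneg _
  have hD₂ : 0 ≤ ∫ z, G₂ z ^ 2 ∂(unitVol.prod unitVol) := integral_nonneg fun z => sq_nonneg _
  generalize (∫ z, F z ^ 2 ∂(unitVol.prod unitVol)) = I at *
  generalize (∫ z, |F z| ∂(unitVol.prod unitVol)) = K at *
  generalize (∫ z, F z ^ 4 ∂(unitVol.prod unitVol)) = Q at *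
  generalize (∫ z, |F z| ^ 3 ∂(unitVol.prod unitVol)) = T at *
  generalize (∫ z, |F z * G₁ z| ∂(unitVol.prod unitVol)) = a at *
  generalize (∫ z, |F z * G₂ z| ∂(unitVol.prod unitVol)) = b at *
  generalize (∫ z, G₁ z ^ 2 ∂(unitVol.prod unitVol)) = D₁ at *
  generalize (∫ z, G₂ z ^ 2 ∂(unitVol.prod unitVol)) = D₂ at *
  have hQ' : Q ≤ (2 * B + 4) * I * (D₁ + D₂) := by
    nlinarith [sq_nonneg ((I + 2 * a) - (I + 2 * b)), sq_nonneg (I - 2 * a),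
      sq_nonneg (I - 2 * b), mul_le_mul_of_nonneg_left hB hI]
  have h4 : (I ^ 2) ^ 2 ≤ K ^ 2 * (I * ((2 * B + 4) * I * (D₁ + D₂))) := by
    calc (I ^ 2) ^ 2 ≤ (K * T) ^ 2 := pow_le_pow_left₀ (sq_nonneg _) h13 2
      _ = K ^ 2 * T ^ 2 := by ring
      _ ≤ K ^ 2 * (I * Q) := by gcongr
      _ ≤ _ := by gcongr
  rcases hI.eq_or_lt with h0 | h0
  · rw [← h0, zero_pow two_ne_zero]
    positivity
  · have hp : 0 < I ^ 2 := by positivity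
    refine le_of_mul_le_mul_left ?_ hp
    linarith

omit hF in
/-- Pointwise form of the Poincaré inequality on the square. -/
lemma sq_sub_le_integral_add_integral {x y : ℝ × ℝ}
    (hx : x ∈ Set.Ico (0:ℝ) 1 ×ˢ Set.Ico (0:ℝ) 1) (hy : y ∈ Set.Ico (0:ℝ) 1 ×ˢ Set.Ico (0:ℝ) 1) :
    (F x - F y) ^ 2 ≤
      2 * (∫ r, G₁ (r, x.2) ^ 2 ∂unitVol) + 2 * ∫ r, G₂ (y.1, r) ^ 2 ∂unitVol := by
  obtain ⟨s, t⟩ := x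
  obtain ⟨u, v⟩ := y
  have b₁ := sq_sub_le_integral_sq_deriv (h := fun r => F (r, t)) (h' := fun r => G₁ (r, t))
    (fun r => hd₁ r t) (by fun_prop) hx.1 hy.1
  have b₂ := sq_sub_le_integral_sq_deriv (h := fun r => F (u, r)) (h' := fun r => G₂ (u, r))
    (fun r => hd₂ u r) (by fun_prop) hx.2 hy.2
  simp only at b₁ b₂ ⊢
  nlinarith [sq_nonneg ((F (s, t) - F (u, t)) - (F (u, t) - F (u, v)))]

section Weighted

variable {w : ℝ × ℝ → ℝ} {m M : ℝ} (hw : Continuous w) (hm : ∀ z, m ≤ w z) (hM : ∀ z, w z ≤ M)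
  (hw1 : ∫ z, w z ∂(unitVol.prod unitVol) = 1)
  (hwF : ∫ z, w z * F z ∂(unitVol.prod unitVol) = 0)

include hw hM hw1 hwF

lemma integral_sq_le_of_weighted_mean_zero (hw0 : ∀ z, 0 ≤ w z) :
    ∫ z, F z ^ 2 ∂(unitVol.prod unitVol) ≤
      2 * M * ∫ z, (G₁ z ^ 2 + G₂ z ^ 2) ∂(unitVol.prod unitVol) := by
  have ci {g : ℝ × ℝ → ℝ} (hg : Continuous g) := hg.integrable_unitVol_prod
  have hM0 : 0 ≤ M := (hw0 0).trans (hM 0)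
  set p : ℝ → ℝ := fun t => ∫ r, G₁ (r, t) ^ 2 ∂unitVol with hp
  set q : ℝ → ℝ := fun u => ∫ r, G₂ (u, r) ^ 2 ∂unitVol with hq
  have ip : Integrable p unitVol :=
    (ci (g := fun z => G₁ z ^ 2) (by fun_prop)).integral_prod_right
  have iq : Integrable q unitVol :=
    (ci (g := fun z => G₂ z ^ 2) (by fun_prop)).integral_prod_left
  have ep : ∫ t, p t ∂unitVol = ∫ z, G₁ z ^ 2 ∂(unitVol.prod unitVol) :=
    (integral_prod_symm _ (ci (g := fun z => G₁ z ^ 2) (by fun_prop))).symm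
  have eq : ∫ t, q t ∂unitVol = ∫ z, G₂ z ^ 2 ∂(unitVol.prod unitVol) :=
    (integral_prod _ (ci (g := fun z => G₂ z ^ 2) (by fun_prop))).symm
  have hpt : ∀ x ∈ Set.Ico (0:ℝ) 1 ×ˢ Set.Ico (0:ℝ) 1,
      F x ^ 2 ≤ M * (2 * p x.2 + 2 * ∫ u, q u ∂unitVol) := by
    intro x hx
    have e1 : ∫ y, w y * (F x - F y) ^ 2 ∂(unitVol.prod unitVol) =
        F x ^ 2 + ∫ y, w y * F y ^ 2 ∂(unitVol.prod unitVol) := by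
      have : ∀ y, w y * (F x - F y) ^ 2 =
          F x ^ 2 * w y - 2 * F x * (w y * F y) + w y * F y ^ 2 := fun y => by ring
      simp_rw [this]
      rw [integral_add (ci (by fun_prop)) (ci (by fun_prop)),
        integral_sub (ci (by fun_prop)) (ci (by fun_prop)), integral_const_mul,
        integral_const_mul, hw1, hwF]
      ring
    have e2 : 0 ≤ ∫ y, w y * F y ^ 2 ∂(unitVol.prod unitVol) :=
      integral_nonneg fun y => mul_nonneg (hw0 y) (sq_nonneg _)
    have e3 : ∫ y, w y * (F x - F y) ^ 2 ∂(unitVol.prod unitVol) ≤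
        ∫ y, M * (2 * p x.2 + 2 * q y.1) ∂(unitVol.prod unitVol) := by
      refine integral_mono_ae (ci (by fun_prop))
        (((integrable_const _).add ((iq.comp_fst _).const_mul 2)).const_mul M) ?_
      filter_upwards [ae_mem_unitVol_prod] with y hy
      exact mul_le_mul (hM y) (sq_sub_le_integral_add_integral hG₁ hG₂ hd₁ hd₂ hx hy)
        (sq_nonneg _) hM0
    rw [integral_const_mul, integral_add (integrable_const _) ((iq.comp_fst _).const_mul 2),
      integral_const_mul, integral_const_mul 2 (fun y : ℝ × ℝ => q y.1), integral_fun_fst] at e3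
    simp only [integral_const, probReal_univ, smul_eq_mul, one_mul] at e3
    linarith
  have hfin : ∫ z, F z ^ 2 ∂(unitVol.prod unitVol) ≤
      ∫ z, M * (2 * p z.2 + 2 * ∫ u, q u ∂unitVol) ∂(unitVol.prod unitVol) := by
    refine integral_mono_ae (ci (by fun_prop))
      ((((ip.comp_snd _).const_mul 2).add (integrable_const _)).const_mul M) ?_
    filter_upwards [ae_mem_unitVol_prod] with z hz
    exact hpt z hz
  rw [integral_const_mul, integral_add ((ip.comp_snd _).const_mul 2) (integrable_const _),
    integral_const_mul, integral_fun_snd] at hfin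
  simp only [integral_const, probReal_univ, smul_eq_mul, one_mul] at hfin
  rw [integral_add (ci (by fun_prop)) (ci (by fun_prop)), ← ep, ← eq]
  linarith

include hm

lemma weighted_poincare_nash (hm0 : 0 < m) :
    ∫ z, w z * F z ^ 2 ∂(unitVol.prod unitVol) ≤
      2 * (M / m) ^ 2 * ∫ z, w z * (G₁ z ^ 2 + G₂ z ^ 2) ∂(unitVol.prod unitVol) ∧
    (∫ z, w z * F z ^ 2 ∂(unitVol.prod unitVol)) ^ 2 ≤
      8 * (M / m) ^ 3 * (∫ z, w z * |F z| ∂(unitVol.prod unitVol)) ^ 2 *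
        ∫ z, w z * (G₁ z ^ 2 + G₂ z ^ 2) ∂(unitVol.prod unitVol) := by
  have ci {g : ℝ × ℝ → ℝ} (hg : Continuous g) := hg.integrable_unitVol_prod
  have hP := integral_sq_le_of_weighted_mean_zero hF hG₁ hG₂ hd₁ hd₂ hw hM hw1 hwF
    fun z => hm0.le.trans (hm z)
  have hM1 : 1 ≤ M := by
    have := integral_mono (ci hw) (integrable_const M) hM
    simpa [hw1] using this
  have hm1 : m ≤ 1 := by
    have := integral_mono (integrable_const m) (ci hw) hm
    simpa [hw1] using this
  have hN := integral_sq_pow_two_le hF hG₁ hG₂ hd₁ hd₂ (by positivity) hP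
  have lower {g : ℝ × ℝ → ℝ} (hg : Continuous g) (hg0 : ∀ z, 0 ≤ g z) :
      ∫ z, g z ∂(unitVol.prod unitVol) ≤ (∫ z, w z * g z ∂(unitVol.prod unitVol)) / m := by
    rw [le_div_iff₀ hm0, mul_comm, ← integral_const_mul]
    exact integral_mono (ci (by fun_prop)) (ci (by fun_prop))
      fun z => mul_le_mul_of_nonneg_right (hm z) (hg0 z)
  have upper {g : ℝ × ℝ → ℝ} (hg : Continuous g) (hg0 : ∀ z, 0 ≤ g z) :
      ∫ z, w z * g z ∂(unitVol.prod unitVol) ≤ M * ∫ z, g z ∂(unitVol.prod unitVol) := by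
    rw [← integral_const_mul]
    exact integral_mono (ci (by fun_prop)) (ci (by fun_prop))
      fun z => mul_le_mul_of_nonneg_right (hM z) (hg0 z)
  have hD := lower (g := fun z => G₁ z ^ 2 + G₂ z ^ 2) (by fun_prop) fun z => by positivity
  have hL := lower (g := fun z => |F z|) (by fun_prop) fun z => by positivity
  have hX := upper (g := fun z => F z ^ 2) (by fun_prop) fun z => by positivity
  have hw0 : ∀ z, 0 ≤ w z := fun z => hm0.le.trans (hm z)
  have hX0 : 0 ≤ ∫ z, w z * F z ^ 2 ∂(unitVol.prod unitVol) :=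
    integral_nonneg fun z => mul_nonneg (hw0 z) (sq_nonneg _)
  have hD0 : 0 ≤ ∫ z, w z * (G₁ z ^ 2 + G₂ z ^ 2) ∂(unitVol.prod unitVol) :=
    integral_nonneg fun z => mul_nonneg (hw0 z) (by positivity)
  have hD0' : 0 ≤ ∫ z, (G₁ z ^ 2 + G₂ z ^ 2) ∂(unitVol.prod unitVol) :=
    integral_nonneg fun z => by positivity
  have hK0 : 0 ≤ ∫ z, |F z| ∂(unitVol.prod unitVol) := integral_nonneg fun z => abs_nonneg _
  generalize (∫ z, F z ^ 2 ∂(unitVol.prod unitVol)) = I at *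
  generalize (∫ z, |F z| ∂(unitVol.prod unitVol)) = K at *
  generalize (∫ z, w z * F z ^ 2 ∂(unitVol.prod unitVol)) = X at *
  generalize (∫ z, w z * |F z| ∂(unitVol.prod unitVol)) = L at *
  generalize (∫ z, w z * (G₁ z ^ 2 + G₂ z ^ 2) ∂(unitVol.prod unitVol)) = D at *
  generalize (∫ z, (G₁ z ^ 2 + G₂ z ^ 2) ∂(unitVol.prod unitVol)) = D₀ at *
  constructor
  · calc X ≤ M * I := hX
      _ ≤ M * (2 * M * (D / m)) := by gcongr; exact hP.trans (by gcongr)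
      _ = 2 * (M / m) ^ 2 * D * m := by field_simp
      _ ≤ 2 * (M / m) ^ 2 * D * 1 := by gcongr
      _ = _ := mul_one _
  · calc X ^ 2 ≤ (M * I) ^ 2 := pow_le_pow_left₀ hX0 hX 2
      _ = M ^ 2 * I ^ 2 := by ring
      _ ≤ M ^ 2 * ((2 * (2 * M) + 4) * K ^ 2 * D₀) := by gcongr
      _ ≤ M ^ 2 * ((8 * M) * (L / m) ^ 2 * (D / m)) := by
        gcongr
        linarith
      _ = _ := by field_simp

end Weighted

end TwoDim

/-- Interpolation between a Poincaré and a Nash inequality. -/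
lemma sqrt_rpow_le_of_poincare_nash {δ X D L E : ℝ} (hδ : δ ∈ Set.Ioo (0:ℝ) 2) (hX : 0 ≤ X)
    (hD : 0 ≤ D) (hL : 0 ≤ L) (hE : 0 ≤ E) (hP : X ≤ E * D) (hN : X ^ 2 ≤ E * D * L ^ 2) :
    Real.sqrt X ^ (4 - δ) ≤ E * D * L ^ (2 - δ) := by
  obtain ⟨h0, h2⟩ := hδ
  have hED : 0 ≤ E * D := mul_nonneg hE hD
  calc Real.sqrt X ^ (4 - δ) = X ^ ((4 - δ) / 2) := by
        rw [Real.sqrt_eq_rpow, ← Real.rpow_mul hX]; congr 1; ring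
    _ = (X ^ 2) ^ (1 - δ / 2) * X ^ (δ / 2) := by
        rw [← Real.rpow_natCast X 2, ← Real.rpow_mul hX, ← Real.rpow_add_of_nonneg hX]
        · congr 1; push_cast; ring
        · push_cast; linarith
        · linarith
    _ ≤ (E * D * L ^ 2) ^ (1 - δ / 2) * (E * D) ^ (δ / 2) := by
        gcongr
        linarith
    _ = (E * D) ^ (1 - δ / 2 + δ / 2) * (L ^ 2) ^ (1 - δ / 2) := by
        rw [Real.mul_rpow hED (sq_nonneg _),
          Real.rpow_add_of_nonneg hED (by linarith) (by linarith)]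
        ring
    _ = E * D * L ^ (2 - δ) := by
        rw [← Real.rpow_natCast L 2, ← Real.rpow_mul hL, sub_add_cancel, Real.rpow_one]
        congr 2; push_cast; ring

lemma setIntegral_box (φ : (Fin 2 → ℝ) → ℝ) :
    ∫ x in box, φ x = ∫ z, φ ![z.1, z.2] ∂(unitVol.prod unitVol) := by
  have hbox : box = MeasurableEquiv.finTwoArrow ⁻¹' (Set.Ico (0:ℝ) 1 ×ˢ Set.Ico (0:ℝ) 1) := by
    ext x
    simp [box, MeasurableEquiv.finTwoArrow]
  rw [unitVol_prod, ← (volume_preserving_finTwoArrow ℝ).setIntegral_preimage_emb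
    MeasurableEquiv.finTwoArrow.measurableEmbedding, ← hbox]
  refine integral_congr_ae (ae_of_all _ fun x => ?_)
  have : ![x 0, x 1] = x := by ext i; fin_cases i <;> rfl
  simp [MeasurableEquiv.finTwoArrow, this]

lemma integral_μm {κ : ℝ} {U : (Fin 2 → ℝ) → ℝ} (hU : Continuous U) (φ : (Fin 2 → ℝ) → ℝ) :
    ∫ x, φ x ∂(μm κ U) = ∫ z : ℝ × ℝ, Real.exp (-(U ![z.1, z.2]) / κ) /
      (∫ y in box, Real.exp (-(U y) / κ)) * φ ![z.1, z.2] ∂(unitVol.prod unitVol) := by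
  have hZ : 0 ≤ ∫ y in box, Real.exp (-(U y) / κ) := integral_nonneg fun y => (Real.exp_pos _).le
  have hmeas : Measurable fun x => ENNReal.ofReal
      (Real.exp (-(U x) / κ) / ∫ y in box, Real.exp (-(U y) / κ)) := by
    have := hU.measurable
    fun_prop
  rw [μm, integral_withDensity_eq_integral_toReal_smul hmeas (by simp), setIntegral_box]
  refine integral_congr_ae (ae_of_all _ fun z => ?_)
  simp only [smul_eq_mul]
  rw [ENNReal.toReal_ofReal (div_nonneg (Real.exp_pos _).le hZ)]

lemma Per.isCompact_range {U : (Fin 2 → ℝ) → ℝ} (hU : Continuous U) (hP : Per U) :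
    IsCompact (Set.range U) := by
  have : Set.range U = U '' Set.Icc 0 1 := by
    refine Set.Subset.antisymm ?_ (Set.image_subset_range _ _)
    rintro _ ⟨x, rfl⟩
    refine ⟨fun i => Int.fract (x i), ⟨fun i => Int.fract_nonneg _,
      fun i => (Int.fract_lt_one _).le⟩, ?_⟩
    rw [← hP (fun i => Int.fract (x i)) fun i => ⌊x i⌋]
    congr 1
    ext i
    exact Int.fract_add_floor (x i)
  rw [this]
  exact isCompact_Icc.image hU

lemma hasDerivAt_fst {f : (Fin 2 → ℝ) → ℝ} (hf : Differentiable ℝ f) (s t : ℝ) :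
    HasDerivAt (fun r => f ![r, t]) (pd f 0 ![s, t]) s := by
  have hc : HasDerivAt (fun r : ℝ => ![r, t]) (Pi.single 0 1) s := by
    rw [hasDerivAt_pi]
    intro i
    fin_cases i
    · simpa using hasDerivAt_id' s
    · simpa using hasDerivAt_const s t
  exact (hf ![s, t]).hasFDerivAt.comp_hasDerivAt s hc

lemma hasDerivAt_snd {f : (Fin 2 → ℝ) → ℝ} (hf : Differentiable ℝ f) (s t : ℝ) :
    HasDerivAt (fun r => f ![s, r]) (pd f 1 ![s, t]) t := by
  have hc : HasDerivAt (fun r : ℝ => ![s, r]) (Pi.single 1 1) t := by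
    rw [hasDerivAt_pi]
    intro i
    fin_cases i
    · simpa using hasDerivAt_const t s
    · simpa using hasDerivAt_id' t
  exact (hf ![s, t]).hasFDerivAt.comp_hasDerivAt t hc

/-- the two-dimensional weighted Nash inequality: for every `δ ∈ (0,2)`
there is a constant `C(δ)` (independent of `U`, `κ` and `f`) such that
`‖f‖_{L²(μ)}^{4-δ} ≤ C(δ) exp(4‖U‖_osc/κ) ‖∇f‖_{L²(μ)}² ‖f‖_{L¹(μ)}^{2-δ}`
for all μ-mean-zero periodic C¹ functions `f`. -/
theorem stmt_7 (δ : ℝ) (hδ : δ ∈ Set.Ioo (0:ℝ) 2) :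
    ∃ C : ℝ, ∀ κ : ℝ, 0 < κ →
      ∀ U : (Fin 2 → ℝ) → ℝ, ContDiff ℝ 2 U → Per U →
      ∀ f : (Fin 2 → ℝ) → ℝ, ContDiff ℝ 1 f → Per f →
        (∫ x, f x ∂(μm κ U)) = 0 →
        (Real.sqrt (∫ x, (f x) ^ 2 ∂(μm κ U))) ^ ((4 : ℝ) - δ)
          ≤ C * Real.exp (4 * oscU U / κ) *
              (∫ x, (∑ i, (pd f i x) ^ 2) ∂(μm κ U)) *
              (∫ x, |f x| ∂(μm κ U)) ^ ((2 : ℝ) - δ) := by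
  refine ⟨8, fun κ hκ U hU hUP f hf _ hmean => ?_⟩
  have hUc : Continuous U := hU.continuous
  have hfc : Continuous f := hf.continuous
  have hpd (i : Fin 2) : Continuous (pd f i) :=
    (hf.continuous_fderiv one_ne_zero).clm_apply continuous_const
  have hvec : Continuous fun z : ℝ × ℝ => ![z.1, z.2] := by fun_prop
  have hrange := Per.isCompact_range hUc hUP
  set S := sSup (Set.range U) with hS
  set s := sInf (Set.range U) with hs
  have hSU (x) : U x ≤ S := le_csSup hrange.bddAbove ⟨x, rfl⟩
  have hsU (x) : s ≤ U x := csInf_le hrange.bddBelow ⟨x, rfl⟩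
  set Z := ∫ y in box, Real.exp (-(U y) / κ) with hZ
  have hlow (x) : Real.exp (-S / κ) ≤ Real.exp (-(U x) / κ) := by
    gcongr; exact hSU x
  have hupp (x) : Real.exp (-(U x) / κ) ≤ Real.exp (-s / κ) := by
    gcongr; exact hsU x
  have hec : Continuous fun z : ℝ × ℝ => Real.exp (-(U ![z.1, z.2]) / κ) := by fun_prop
  have hZ' : Z = ∫ z : ℝ × ℝ, Real.exp (-(U ![z.1, z.2]) / κ) ∂(unitVol.prod unitVol) :=
    setIntegral_box _
  have hZ0 : 0 < Z := by
    have := integral_mono (integrable_const _) hec.integrable_unitVol_prod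
      fun z : ℝ × ℝ => hlow ![z.1, z.2]
    rw [← hZ'] at this
    simp only [integral_const, probReal_univ, smul_eq_mul, one_mul] at this
    exact (Real.exp_pos _).trans_le this
  have hw1 : ∫ z : ℝ × ℝ, Real.exp (-(U ![z.1, z.2]) / κ) / Z ∂(unitVol.prod unitVol) = 1 := by
    rw [integral_div, ← hZ', div_self hZ0.ne']
  have hratio : Real.exp (-s / κ) / Z / (Real.exp (-S / κ) / Z) = Real.exp (oscU U / κ) := by
    rw [div_div_div_cancel_right₀ hZ0.ne', ← Real.exp_sub, oscU, ← hS, ← hs]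
    congr 1; ring
  have hosc : 0 ≤ oscU U / κ := div_nonneg (sub_nonneg.2 ((hsU 0).trans (hSU 0))) hκ.le
  rw [integral_μm hUc] at hmean
  obtain ⟨hP, hN⟩ := weighted_poincare_nash (F := fun z => f ![z.1, z.2])
    (G₁ := fun z => pd f 0 ![z.1, z.2]) (G₂ := fun z => pd f 1 ![z.1, z.2])
    (hfc.comp hvec) ((hpd 0).comp hvec) ((hpd 1).comp hvec)
    (hasDerivAt_fst (hf.differentiable one_ne_zero))
    (hasDerivAt_snd (hf.differentiable one_ne_zero)) (hec.div_const Z)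
    (fun z => div_le_div_of_nonneg_right (hlow ![z.1, z.2]) hZ0.le)
    (fun z => div_le_div_of_nonneg_right (hupp ![z.1, z.2]) hZ0.le) hw1 hmean (by positivity)
  rw [hratio, ← Real.exp_nat_mul] at hP hN
  simp only [integral_μm hUc, Fin.sum_univ_two, ← hZ]
  have hD : 0 ≤ ∫ z : ℝ × ℝ, Real.exp (-(U ![z.1, z.2]) / κ) / Z *
      (pd f 0 ![z.1, z.2] ^ 2 + pd f 1 ![z.1, z.2] ^ 2) ∂(unitVol.prod unitVol) :=
    integral_nonneg fun z => by positivity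
  refine sqrt_rpow_le_of_poincare_nash hδ (integral_nonneg fun z => by positivity) hD
    (integral_nonneg fun z => by positivity) (by positivity) (hP.trans ?_) (hN.trans ?_)
  · gcongr ?_ * ?_ * _
    · norm_num
    · rw [mul_div_assoc]
      gcongr
      norm_num
  · rw [mul_right_comm]
    gcongr ?_ * ?_ * _ * _
    rw [mul_div_assoc]
    gcongr
    norm_num
end

section
/- Let a, b, T > 0 satisfy T = a · exp(−b√T). Then T ≤ (1 + (ln(a b²))²)/b². -/
/-- if `a, b, T > 0` satisfy `T = a e^{-b√T}`, then
`T ≤ (1 + (ln(a b²))²)/b²`. -/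
theorem stmt_9 (a b T : ℝ) (ha : 0 < a) (hb : 0 < b) (hT : 0 < T)
    (h : T = a * Real.exp (-b * Real.sqrt T)) :
    T ≤ (1 + (Real.log (a * b ^ 2)) ^ 2) / b ^ 2 := by
  obtain ⟨s, hs⟩ : ∃ s, s = b * Real.sqrt T := ⟨_, rfl⟩
  have hs_pos : 0 < s := hs ▸ mul_pos hb (Real.sqrt_pos.mpr hT)
  have hs_sq : s ^ 2 = T * b ^ 2 := by
    rw [hs, mul_pow, Real.sq_sqrt hT.le, mul_comm]
  have hlogT : Real.log T = Real.log a - s := by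
    have h_log := congrArg Real.log h
    rw [Real.log_mul ha.ne' (Real.exp_ne_zero _), Real.log_exp, neg_mul, ← hs] at h_log
    linarith
  have hlog : Real.log (a * b ^ 2) = 2 * Real.log s + s := by
    have h_log := congrArg Real.log hs_sq
    rw [Real.log_mul hT.ne' (by positivity), Real.log_pow, Nat.cast_ofNat] at h_log
    rw [Real.log_mul ha.ne' (by positivity)]
    linarith
  rw [le_div_iff₀ (by positivity), ← hs_sq, hlog]
  rcases le_total s 1 with hs_le | hs_ge
  · nlinarith [sq_nonneg (2 * Real.log s + s)]
  · nlinarith [Real.log_nonneg hs_ge, mul_nonneg (Real.log_nonneg hs_ge) hs_pos.le]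
end

section
/- Let F : ℝ → ℝ be the 1-periodic localized tent function: F(x) = 0 whenever x mod 1 ∈ [0, 3/8] ∪ [5/8, 1], F is affine increasing from 0 to 1 on [3/8, 1/2], and affine decreasing from 1 to 0 on [1/2, 5/8]. On the torus T² = (ℝ/ℤ)², for parameters α, β ∈ [0,1] define the shear maps S_{α,β,1}(x₁,x₂) = (x₁ + β F(x₂ − α), x₂) and S_{α,β,2}(x₁,x₂) = (x₁, x₂ + β F(x₁ − α)). Then for every two pairs of distinct points (x, y) and (w, z) in T² × T² with x ≠ y and w ≠ z, there exists a finite sequence of parameters (α₁,β₁,i₁), …, (α_n,β_n,i_n) ∈ [0,1] × [0,1] × {1,2} such that the composition G = S_{α_n,β_n,i_n} ∘ ⋯ ∘ S_{α₁,β₁,i₁} satisfies G(x) = w and G(y) = z. -/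
/-- The 1-periodic localized tent function: `0` off `[3/8, 5/8]` (mod 1), affine
increasing from `0` to `1` on `[3/8, 1/2]`, affine decreasing from `1` to `0` on
`[1/2, 5/8]`. -/
noncomputable def Ftent (x : ℝ) : ℝ :=
  if Int.fract x < 3/8 then 0
  else if Int.fract x ≤ 1/2 then 8 * Int.fract x - 3
  else if Int.fract x ≤ 5/8 then 5 - 8 * Int.fract x
  else 0

lemma Ftent_periodic : Function.Periodic Ftent 1 := by
  intro x; simp [Ftent, Int.fract_add_one]

/-- The localized tent function, descended to the circle `ℝ/ℤ`. -/
noncomputable def FtentC : AddCircle (1:ℝ) → ℝ := Ftent_periodic.lift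

/-- The shear maps of the torus `T² = (ℝ/ℤ)²`:
`S_{α,β,1}(x₁,x₂) = (x₁ + βF(x₂-α), x₂)` and `S_{α,β,2}(x₁,x₂) = (x₁, x₂ + βF(x₁-α))`
(`i = true` encodes the horizontal shear `S_{α,β,1}`). -/
noncomputable def shear (α β : ℝ) (i : Bool) (p : Fin 2 → AddCircle (1:ℝ)) :
    Fin 2 → AddCircle (1:ℝ) :=
  if i then ![p 0 + ↑(β * FtentC (p 1 - (α : AddCircle (1:ℝ)))), p 1]
  else ![p 0, p 1 + ↑(β * FtentC (p 0 - (α : AddCircle (1:ℝ))))]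

lemma FtentC_coe (x : ℝ) : FtentC (x : AddCircle (1:ℝ)) = Ftent x :=
  Ftent_periodic.lift_coe x

lemma AddCircle.exists_coe_eq_of_unit (a : AddCircle (1:ℝ)) :
    ∃ r : ℝ, 0 ≤ r ∧ r < 1 ∧ (r : AddCircle (1:ℝ)) = a := by
  have : Fact ((0:ℝ) < 1) := ⟨one_pos⟩
  obtain ⟨⟨r, hr⟩, h⟩ := (AddCircle.equivIco (1:ℝ) 0).symm.surjective a
  exact ⟨r, hr.1, by simpa using hr.2, h⟩

lemma Ftent_eq_zero {x : ℝ} (h0 : 0 ≤ x) (h1 : x < 1) (h : x ≤ 3/8 ∨ 5/8 ≤ x) :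
    Ftent x = 0 := by
  have hf : Int.fract x = x := Int.fract_eq_self.2 ⟨h0, h1⟩
  unfold Ftent
  rw [hf]
  split_ifs <;> first | rfl | (rcases h with h | h <;> linarith)

lemma Ftent_pos {x : ℝ} (h0 : 3/8 < x) (h1 : x < 5/8) : 0 < Ftent x := by
  have hf : Int.fract x = x := Int.fract_eq_self.2 ⟨by linarith, by linarith⟩
  unfold Ftent
  rw [hf]
  split_ifs <;> linarith

/-- Two distinct points of the circle are separated by a translate of the tent function. -/
lemma exists_FtentC_separating {a b : AddCircle (1:ℝ)} (hab : a ≠ b) :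
    ∃ α ∈ Set.Icc (0:ℝ) 1, FtentC (a - (α : AddCircle (1:ℝ))) = 0 ∧
      0 < FtentC (b - (α : AddCircle (1:ℝ))) := by
  suffices h : ∃ u v : ℝ, (v : AddCircle (1:ℝ)) - u = b - a ∧ Ftent u = 0 ∧ 0 < Ftent v by
    obtain ⟨u, v, huv, hu, hv⟩ := h
    obtain ⟨α, h0, h1, hα⟩ := AddCircle.exists_coe_eq_of_unit (a - u)
    refine ⟨α, ⟨h0, h1.le⟩, ?_, ?_⟩
    · rw [hα, sub_sub_cancel, FtentC_coe, hu]
    · have : b - (α : AddCircle (1:ℝ)) = v := by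
        rw [hα, ← sub_eq_zero]
        calc b - (a - u) - (v : AddCircle (1:ℝ)) = (b - a) - (v - u) := by abel
          _ = 0 := by rw [huv, sub_self]
      rwa [this, FtentC_coe]
  obtain ⟨s, h0, h1, hs⟩ := AddCircle.exists_coe_eq_of_unit (b - a)
  have hs0 : 0 < s := by
    refine h0.lt_of_ne ?_
    rintro rfl
    exact hab (sub_eq_zero.1 (by simpa using hs.symm)).symm
  have hone : ((1:ℝ) : AddCircle (1:ℝ)) = 0 := AddCircle.coe_period 1
  rcases lt_or_ge s (1/4) with h | h
  · exact ⟨3/8, 3/8 + s, by rw [AddCircle.coe_add, add_sub_cancel_left, hs],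
      Ftent_eq_zero (by norm_num) (by norm_num) (by norm_num),
      Ftent_pos (by linarith) (by linarith)⟩
  rcases lt_or_ge (3/4) s with h' | h'
  · exact ⟨5/8, 5/8 + s - 1, by
      rw [AddCircle.coe_sub, AddCircle.coe_add, hone, sub_zero, add_sub_cancel_left, hs],
      Ftent_eq_zero (by norm_num) (by norm_num) (by norm_num),
      Ftent_pos (by linarith) (by linarith)⟩
  · refine ⟨1/2 - s, 1/2, by rw [AddCircle.coe_sub, sub_sub_cancel, hs], ?_,
      Ftent_pos (by norm_num) (by norm_num)⟩
    rcases le_or_gt s (1/2) with h2 | h2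
    · exact Ftent_eq_zero (by linarith) (by linarith) (Or.inl (by linarith))
    · rw [← Ftent_periodic]
      exact Ftent_eq_zero (by linarith) (by linarith) (Or.inr (by linarith))

lemma shear_eq_update (α β : ℝ) (j : Fin 2) (p : Fin 2 → AddCircle (1:ℝ)) :
    shear α β (decide (j = 0)) p =
      Function.update p j (p j + ↑(β * FtentC (p (j + 1) - (α : AddCircle (1:ℝ))))) := by
  fin_cases j <;> funext k <;> fin_cases k <;> simp [shear]

lemma foldl_replicate_shear (α β : ℝ) (j : Fin 2) (n : ℕ) (p : Fin 2 → AddCircle (1:ℝ)) :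
    (List.replicate n (α, β, decide (j = 0))).foldl (fun p q => shear q.1 q.2.1 q.2.2 p) p =
      Function.update p j
        (p j + ↑(n * (β * FtentC (p (j + 1) - (α : AddCircle (1:ℝ)))))) := by
  have hj : j + 1 ≠ j := by fin_cases j <;> decide
  induction n generalizing p with
  | zero => simp
  | succ n ih =>
    rw [List.replicate_succ, List.foldl_cons, ih]
    simp only [shear_eq_update, Function.update_self, Function.update_of_ne hj,
      Function.update_idem]
    congr 1
    rw [add_assoc, ← AddCircle.coe_add]
    congr 2
    push_cast
    ring

/-- The pair `(w, z)` is the image of the pair `(x, y)` under a finite composition of shears. -/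
def ShearReachable (x y w z : Fin 2 → AddCircle (1:ℝ)) : Prop :=
  ∃ L : List (ℝ × ℝ × Bool),
    (∀ q ∈ L, q.1 ∈ Set.Icc (0:ℝ) 1 ∧ q.2.1 ∈ Set.Icc (0:ℝ) 1) ∧
    L.foldl (fun p q => shear q.1 q.2.1 q.2.2 p) x = w ∧
    L.foldl (fun p q => shear q.1 q.2.1 q.2.2 p) y = z

namespace ShearReachable

variable {x y w z u v : Fin 2 → AddCircle (1:ℝ)}

lemma swap (h : ShearReachable x y w z) : ShearReachable y x z w := by
  obtain ⟨L, hL, h1, h2⟩ := h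
  exact ⟨L, hL, h2, h1⟩

lemma trans (h : ShearReachable x y w z) (h' : ShearReachable w z u v) :
    ShearReachable x y u v := by
  obtain ⟨L, hL, rfl, rfl⟩ := h
  obtain ⟨L', hL', rfl, rfl⟩ := h'
  refine ⟨L ++ L', fun q hq => ?_, List.foldl_append, List.foldl_append⟩
  exact (List.mem_append.1 hq).elim (hL q) (hL' q)

lemma update_right (j : Fin 2) (h : x (j + 1) ≠ y (j + 1)) (t : AddCircle (1:ℝ)) :
    ShearReachable x y x (Function.update y j t) := by
  obtain ⟨α, hα, hx, hy⟩ := exists_FtentC_separating h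
  obtain ⟨r, hr0, -, hr⟩ := AddCircle.exists_coe_eq_of_unit (t - y j)
  set c := FtentC (y (j + 1) - (α : AddCircle (1:ℝ))) with hc
  obtain ⟨n, hn⟩ := exists_nat_gt (r / c)
  have hn0 : (0:ℝ) < n := (div_nonneg hr0 hy.le).trans_lt hn
  refine ⟨List.replicate n (α, r / c / n, decide (j = 0)), fun q hq => ?_, ?_, ?_⟩
  · rw [List.eq_of_mem_replicate hq]
    exact ⟨hα, by positivity, (div_le_one hn0).2 hn.le⟩
  · rw [foldl_replicate_shear, hx]
    simp
  · have hnr : n * (r / c / n * c) = r := by field_simp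
    rw [foldl_replicate_shear, ← hc, hnr, hr, add_sub_cancel]

/-- If one coordinate of the two points differs, the other one can be prescribed freely. -/
lemma update_both (j : Fin 2) (h : x (j + 1) ≠ y (j + 1)) (s t : AddCircle (1:ℝ)) :
    ShearReachable x y (Function.update x j s) (Function.update y j t) := by
  have hj : j + 1 ≠ j := by fin_cases j <;> decide
  refine (update_right j h t).trans (update_right j ?_ s).swap
  rw [Function.update_of_ne hj]
  exact h.symm

lemma of_ne (j : Fin 2) (h : x (j + 1) ≠ y (j + 1)) (h' : w j ≠ z j) :
    ShearReachable x y w z := by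
  have hj : j + 1 ≠ j := by fin_cases j <;> decide
  have hj2 : j + 1 + 1 = j := by fin_cases j <;> rfl
  have key : ∀ a b : Fin 2 → AddCircle (1:ℝ),
      Function.update (Function.update a j (b j)) (j + 1) (b (j + 1)) = b := by
    intro a b
    funext k
    fin_cases j <;> fin_cases k <;> simp
  have h2 := (update_both j h (w j) (z j)).trans
    (update_both (j + 1) (by simpa [hj2] using h') (w (j + 1)) (z (j + 1)))
  rwa [key, key] at h2

end ShearReachable

/-- two-point controllability of the localized tent shears: for any two
pairs of distinct points `(x,y)` and `(w,z)` of the torus `T²`, some finite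
composition `G` of shears `S_{α,β,i}` with parameters `α, β ∈ [0,1]`, `i ∈ {1,2}`
satisfies `G x = w` and `G y = z`. -/
theorem stmt_18 (x y w z : Fin 2 → AddCircle (1:ℝ)) (hxy : x ≠ y) (hwz : w ≠ z) :
    ∃ L : List (ℝ × ℝ × Bool),
      (∀ q ∈ L, q.1 ∈ Set.Icc (0:ℝ) 1 ∧ q.2.1 ∈ Set.Icc (0:ℝ) 1) ∧
      L.foldl (fun p q => shear q.1 q.2.1 q.2.2 p) x = w ∧
      L.foldl (fun p q => shear q.1 q.2.1 q.2.2 p) y = z := by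
  change ShearReachable x y w z
  obtain ⟨i, hi⟩ := Function.ne_iff.1 hxy
  obtain ⟨k, hk⟩ := Function.ne_iff.1 hwz
  have h2 : ∀ j : Fin 2, j + 1 + 1 = j := by decide
  by_cases hik : k = i + 1
  · exact .of_ne (i + 1) (by rwa [h2]) (hik ▸ hk)
  · obtain rfl : k = i := by
      fin_cases i <;> fin_cases k <;> simp_all
    have hhalf : (0 : AddCircle (1:ℝ)) ≠ ((1/2 : ℝ) : AddCircle (1:ℝ)) := by
      intro h
      have hF := congrArg FtentC h
      rw [← AddCircle.coe_zero, FtentC_coe, FtentC_coe,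
        Ftent_eq_zero le_rfl one_pos (by norm_num)] at hF
      exact (Ftent_pos (x := 1/2) (by norm_num) (by norm_num)).ne hF
    exact (ShearReachable.update_both (k + 1) (by rwa [h2]) 0 ((1/2 : ℝ) : AddCircle (1:ℝ))).trans
      (.of_ne k (by simpa using hhalf) hk)
end
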